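/- Let m, k₁, k₂ be integers with m ≥ 9 and 2 ≤ k₁ < k₁ + 1 < k₂ ≤ ⌊(m−1)/2⌋, and let g be the characteristic-type function defined from the weight classes B, C, D. Then Re(ĝ(0)) = 3^m − (3/2)·Σ_{j=k₁}^{k₂} 2^j·C(m,j), and for every w ∈ F₃^m with Hamming weight wt(w) = i ≥ 1, Re(ĝ(w)) = −(3/2)·(Ψ_{k₂}(i,m) − Ψ_{k₁−1}(i,m)). -/

import Mathlib

open Finset

/-- `ζ₃ = e^{2πi/3}`, a primitive complex cube root of unity. -/
noncomputable def zeta3 : ℂ := Complex.exp (2 * Real.pi * Complex.I / 3)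

/-- `ζ₃^a` for `a ∈ F₃`. -/
noncomputable def chi (a : ZMod 3) : ℂ := zeta3 ^ a.val

/-- Standard inner product on `F₃^m`. -/
def dotp {m : ℕ} (w x : Fin m → ZMod 3) : ZMod 3 := ∑ i, w i * x i

/-- Walsh transform of `F : F₃^m → F₃`. -/
noncomputable def walsh {m : ℕ} (F : (Fin m → ZMod 3) → ZMod 3)
    (w : Fin m → ZMod 3) : ℂ :=
  ∑ x : Fin m → ZMod 3, chi (F x - dotp w x)

/-- Ternary Krawtchouk polynomial `K_t(x,m)`. -/
def Kraw (t x m : ℕ) : ℤ :=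
  ∑ j ∈ Finset.range (t + 1),
    (-1 : ℤ) ^ j * 2 ^ (t - j) * (x.choose j : ℤ) * ((m - x).choose (t - j) : ℤ)

/-- Lloyd polynomial `Ψ_k(x,m) = Σ_{t=0}^k K_t(x,m)`. -/
def Lloyd (k x m : ℕ) : ℤ := ∑ t ∈ Finset.range (k + 1), Kraw t x m

/-- `f(x) = 1` iff `x ∈ A ∪ C ∪ D`, i.e. `1 ≤ wt(x) ≤ k₂` and `wt(x) ≠ k₁`. -/
def ffun (m k₁ k₂ : ℕ) (x : Fin m → ZMod 3) : ZMod 3 :=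
  if 1 ≤ hammingNorm x ∧ hammingNorm x ≤ k₂ ∧ hammingNorm x ≠ k₁ then 1 else 0

/-- `g(x) = 1` on `B ∪ C` (i.e. `k₁ ≤ wt(x) ≤ k₂ - 1`), `g(x) = -1` on `D` (`wt(x) = k₂`). -/
def gfun (m k₁ k₂ : ℕ) (x : Fin m → ZMod 3) : ZMod 3 :=
  if k₁ ≤ hammingNorm x ∧ hammingNorm x ≤ k₂ - 1 then 1
  else if hammingNorm x = k₂ then -1 else 0

/-- The codeword `c(u,r,v)` of `C_{f,g}` for the specific `f = ffun`, `g = gfun`. -/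
def cw (m k₁ k₂ : ℕ) (u r : ZMod 3) (v : Fin m → ZMod 3) :
    {x : Fin m → ZMod 3 // x ≠ 0} → ZMod 3 :=
  fun x => u * ffun m k₁ k₂ x.1 + r * gfun m k₁ k₂ x.1 + dotp v x.1

/-- Hamming weight of the codeword `c(u,r,v)`. -/
def cwt (m k₁ k₂ : ℕ) (u r : ZMod 3) (v : Fin m → ZMod 3) : ℕ :=
  (Finset.univ.filter
    (fun x : {x : Fin m → ZMod 3 // x ≠ 0} => cw m k₁ k₂ u r v x ≠ 0)).card

open Polynomial in
/-- The weight enumerator of `F₃^m` twisted by the character `x ↦ ζ₃^{w·x}`. -/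
noncomputable def twistedEnumerator {m : ℕ} (w : Fin m → ZMod 3) : ℂ[X] :=
  ∑ x : Fin m → ZMod 3, C (chi (dotp w x)) * X ^ hammingNorm x

lemma zeta3_pow_three : zeta3 ^ 3 = 1 := by
  rw [zeta3, ← Complex.exp_nat_mul, ← Complex.exp_two_pi_mul_I]
  congr 1
  push_cast
  ring

lemma zeta3_re : zeta3.re = -1 / 2 := by
  have h : zeta3 = Complex.exp (((Real.pi - Real.pi / 3 : ℝ) : ℂ) * Complex.I) := by
    rw [zeta3]
    congr 1
    push_cast
    ring
  rw [h, Complex.exp_ofReal_mul_I_re, Real.cos_pi_sub, Real.cos_pi_div_three]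
  ring

lemma one_add_zeta3_add_sq : 1 + zeta3 + zeta3 ^ 2 = 0 := by
  have hne : zeta3 - 1 ≠ 0 := by
    intro h
    have := congrArg Complex.re h
    rw [Complex.sub_re, zeta3_re] at this
    norm_num at this
  have h : (zeta3 - 1) * (1 + zeta3 + zeta3 ^ 2) = 0 := by
    linear_combination zeta3_pow_three
  exact (mul_eq_zero.mp h).resolve_left hne

lemma chi_zero : chi 0 = 1 := by simp [chi]

lemma chi_add (a b : ZMod 3) : chi (a + b) = chi a * chi b := by
  rw [chi, chi, chi, ← pow_add, ZMod.val_add]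
  conv_rhs => rw [← Nat.mod_add_div (a.val + b.val) 3, pow_add, pow_mul, zeta3_pow_three, one_pow,
    mul_one]

lemma chi_sum {ι : Type*} (s : Finset ι) (f : ι → ZMod 3) :
    chi (∑ i ∈ s, f i) = ∏ i ∈ s, chi (f i) := by
  classical
  induction s using Finset.induction_on with
  | empty => simp [chi_zero]
  | insert a s ha ih => rw [sum_insert ha, prod_insert ha, chi_add, ih]

lemma chi_one : chi 1 = zeta3 := by
  rw [chi, show (1 : ZMod 3).val = 1 from rfl, pow_one]

lemma chi_two : chi 2 = zeta3 ^ 2 := by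
  rw [chi, show (2 : ZMod 3).val = 2 from rfl]

lemma chi_re (a : ZMod 3) : (chi a).re = if a = 0 then 1 else -1 / 2 := by
  have h2 : zeta3 ^ 2 = -1 - zeta3 := by linear_combination one_add_zeta3_add_sq
  have : a = 0 ∨ a = 1 ∨ a = 2 := by revert a; decide
  rcases this with rfl | rfl | rfl
  · simp [chi_zero]
  · rw [chi_one, zeta3_re, if_neg (by decide)]
  · rw [chi_two, h2, if_neg (by decide), Complex.sub_re, zeta3_re]
    norm_num

lemma chi_sub_re_add_chi_add_re (a b : ZMod 3) :
    (chi (a - b)).re + (chi (a + b)).re = 2 * ((chi a).re * (chi b).re) := by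
  have key : ∀ a b : ZMod 3, a ≠ 0 → b ≠ 0 →
      (a - b = 0 ∧ a + b ≠ 0) ∨ (a - b ≠ 0 ∧ a + b = 0) := by decide
  simp only [chi_re]
  rcases eq_or_ne a 0 with rfl | ha
  · simp only [zero_sub, zero_add, neg_eq_zero, if_true]
    ring
  rcases eq_or_ne b 0 with rfl | hb
  · simp only [sub_zero, add_zero, if_true]
    ring
  rcases key a b ha hb with ⟨h, h'⟩ | ⟨h, h'⟩ <;> simp only [ha, hb, h, h'] <;> norm_num

open Polynomial in
lemma twistedEnumerator_factor (a : ZMod 3) :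
    ∑ b : ZMod 3, C (chi (a * b)) * (X : ℂ[X]) ^ (if b ≠ 0 then 1 else 0)
      = if a ≠ 0 then 1 - X else 1 + 2 * X := by
  have hs : ∀ f : ZMod 3 → ℂ[X], ∑ b, f b = f 0 + f 1 + f 2 := fun f => Fin.sum_univ_three f
  have hC : C zeta3 + C zeta3 ^ 2 = (-1 : ℂ[X]) := by
    have := congrArg (C : ℂ →+* ℂ[X]) one_add_zeta3_add_sq
    simp only [map_add, map_pow, map_one, map_zero] at this
    linear_combination this
  have h1 : (1 : ZMod 3) ≠ 0 := by decide
  have h2 : (2 : ZMod 3) ≠ 0 := by decide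
  have : a = 0 ∨ a = 1 ∨ a = 2 := by revert a; decide
  rw [hs]
  rcases this with rfl | rfl | rfl
  · simp [h1, h2, chi_zero]
    ring
  · simp [h1, h2, chi_zero, chi_one, chi_two]
    linear_combination X * hC
  · rw [show (2 : ZMod 3) * 2 = 1 from rfl]
    simp [h1, h2, chi_zero, chi_one, chi_two]
    linear_combination X * hC

open Polynomial in
lemma twistedEnumerator_eq {m : ℕ} (w : Fin m → ZMod 3) :
    twistedEnumerator w
      = (1 - X) ^ hammingNorm w * (1 + 2 * X) ^ (m - hammingNorm w) := by
  have h : twistedEnumerator w = ∏ i, ∑ b : ZMod 3,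
      C (chi (w i * b)) * (X : ℂ[X]) ^ (if b ≠ 0 then 1 else 0) := by
    rw [prod_univ_sum, Fintype.piFinset_univ, twistedEnumerator]
    refine sum_congr rfl fun x _ => ?_
    rw [prod_mul_distrib, prod_pow_eq_pow_sum, dotp, chi_sum, map_prod, hammingNorm,
      card_filter]
  have hc : #{i | ¬ w i ≠ 0} = m - hammingNorm w := by
    have := card_filter_add_card_filter_not (s := (univ : Finset (Fin m))) (fun i => w i ≠ 0)
    rw [card_univ, Fintype.card_fin] at this
    rw [hammingNorm]
    omega
  simp_rw [h, twistedEnumerator_factor, prod_ite, prod_const, hc]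
  rfl

open Polynomial in
lemma coeff_one_add_C_mul_X_pow (c : ℂ) (n k : ℕ) :
    ((1 + C c * X) ^ n : ℂ[X]).coeff k = c ^ k * n.choose k := by
  have h : ((1 + C c * X) ^ n : ℂ[X]) = ((1 + X) ^ n).comp (C c * X) := by simp
  rw [h, comp_C_mul_X_coeff, coeff_one_add_X_pow, mul_comm]

open Polynomial in
lemma coeff_twistedEnumerator {m : ℕ} (w : Fin m → ZMod 3) (t : ℕ) :
    (twistedEnumerator w).coeff t = (Kraw t (hammingNorm w) m : ℂ) := by
  have h1 : (1 - X : ℂ[X]) = 1 + C (-1) * X := by simp [sub_eq_add_neg]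
  have h2 : (1 + 2 * X : ℂ[X]) = 1 + C 2 * X := rfl
  rw [twistedEnumerator_eq, h1, h2, coeff_mul, Finset.Nat.sum_antidiagonal_eq_sum_range_succ_mk,
    Kraw, Int.cast_sum]
  refine sum_congr rfl fun j _ => ?_
  rw [coeff_one_add_C_mul_X_pow, coeff_one_add_C_mul_X_pow]
  push_cast
  ring

lemma sum_chi_dotp_of_hammingNorm_eq {m : ℕ} (w : Fin m → ZMod 3) (t : ℕ) :
    ∑ x : Fin m → ZMod 3 with hammingNorm x = t, chi (dotp w x)
      = (Kraw t (hammingNorm w) m : ℂ) := by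
  rw [← coeff_twistedEnumerator, twistedEnumerator, Polynomial.finsetSum_coeff, sum_filter]
  refine sum_congr rfl fun x _ => ?_
  rw [Polynomial.coeff_C_mul, Polynomial.coeff_X_pow]
  simp [eq_comm]

lemma sum_chi_dotp {m : ℕ} (w : Fin m → ZMod 3) :
    ∑ x : Fin m → ZMod 3, chi (dotp w x) = if hammingNorm w = 0 then 3 ^ m else 0 := by
  have h := congrArg (Polynomial.eval 1) (twistedEnumerator_eq w)
  rw [twistedEnumerator, Polynomial.eval_finsetSum] at h
  simp only [Polynomial.eval_mul, Polynomial.eval_C, Polynomial.eval_pow, Polynomial.eval_X,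
    one_pow, mul_one, Polynomial.eval_sub, Polynomial.eval_add, Polynomial.eval_one,
    Polynomial.eval_ofNat, sub_self] at h
  rw [h]
  split_ifs with hw
  · rw [hw]
    norm_num
  · rw [zero_pow hw, zero_mul]

/-- An even function on `F₃^m` has the Walsh spectrum of a real-valued cosine sum. -/
lemma walsh_re_of_even {m : ℕ} {F : (Fin m → ZMod 3) → ZMod 3} (hF : ∀ x, F (-x) = F x)
    (w : Fin m → ZMod 3) :
    (walsh F w).re = ∑ x, (chi (F x)).re * (chi (dotp w x)).re := by
  have h1 : (walsh F w).re = ∑ x, (chi (F x - dotp w x)).re := by rw [walsh, Complex.re_sum]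
  have h2 : (walsh F w).re = ∑ x, (chi (F x + dotp w x)).re := by
    rw [h1]
    refine Fintype.sum_equiv (Equiv.neg _) _ _ fun x => ?_
    simp [hF, dotp, sub_eq_add_neg]
  have h3 := congrArg₂ (· + ·) h1 h2
  simp only [← sum_add_distrib, chi_sub_re_add_chi_add_re, ← mul_sum] at h3
  linarith

lemma gfun_neg (m k₁ k₂ : ℕ) (x : Fin m → ZMod 3) : gfun m k₁ k₂ (-x) = gfun m k₁ k₂ x := by
  have : hammingNorm (-x) = hammingNorm x := by simp [hammingNorm]
  rw [gfun, gfun, this]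

lemma chi_gfun_re {m k₁ k₂ : ℕ} (hk : k₁ < k₂) (x : Fin m → ZMod 3) :
    (chi (gfun m k₁ k₂ x)).re
      = 1 - 3 / 2 * (if hammingNorm x ∈ Icc k₁ k₂ then 1 else 0) := by
  have h1 : (1 : ZMod 3) ≠ 0 := by decide
  have h2 : (-1 : ZMod 3) ≠ 0 := by decide
  rw [chi_re, gfun]
  simp only [mem_Icc]
  split_ifs <;> first | omega | contradiction | norm_num

lemma walsh_gfun_re {m k₁ k₂ : ℕ} (hk : k₁ < k₂) (w : Fin m → ZMod 3) :
    (walsh (gfun m k₁ k₂) w).re = (if hammingNorm w = 0 then 3 ^ m else 0)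
      - 3 / 2 * ∑ t ∈ Icc k₁ k₂, (Kraw t (hammingNorm w) m : ℝ) := by
  have hK : ∀ t, (Kraw t (hammingNorm w) m : ℝ)
      = ∑ x : Fin m → ZMod 3 with hammingNorm x = t, (chi (dotp w x)).re := fun t => by
    rw [← Complex.re_sum, sum_chi_dotp_of_hammingNorm_eq, Complex.intCast_re]
  have hT : ∑ x : Fin m → ZMod 3, (chi (dotp w x)).re
      = if hammingNorm w = 0 then 3 ^ m else 0 := by
    rw [← Complex.re_sum, sum_chi_dotp]
    split_ifs
    · exact_mod_cast Complex.ofReal_re (3 ^ m)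
    · rfl
  rw [walsh_re_of_even (gfun_neg m k₁ k₂), ← hT]
  simp_rw [hK, chi_gfun_re hk, sub_mul, one_mul, mul_assoc, sum_sub_distrib, ← mul_sum,
    sum_filter]
  rw [sum_comm]
  congr 2
  refine sum_congr rfl fun x _ => ?_
  rw [sum_ite_eq, ite_mul, one_mul, zero_mul]

lemma Kraw_zero (t m : ℕ) : Kraw t 0 m = 2 ^ t * m.choose t := by
  rw [Kraw, sum_eq_single_of_mem 0 (by simp)]
  · simp
  · intro j _ hj
    simp [Nat.choose_eq_zero_of_lt (Nat.pos_of_ne_zero hj)]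

lemma Lloyd_sub_Lloyd {k₁ k₂ : ℕ} (h₁ : 1 ≤ k₁) (h : k₁ ≤ k₂) (x m : ℕ) :
    Lloyd k₂ x m - Lloyd (k₁ - 1) x m = ∑ t ∈ Icc k₁ k₂, Kraw t x m := by
  rw [Lloyd, Lloyd, Nat.sub_add_cancel h₁, ← sum_Ico_eq_sub _ (by omega)]
  rfl

theorem stmt4 (m k₁ k₂ : ℕ) (hm : 9 ≤ m) (hk₁ : 2 ≤ k₁) (hk : k₁ + 1 < k₂)
    (hk₂ : k₂ ≤ (m - 1) / 2) :
    (walsh (gfun m k₁ k₂) (0 : Fin m → ZMod 3)).re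
      = 3 ^ m - 3 / 2 * (∑ j ∈ Finset.Icc k₁ k₂, (2 : ℝ) ^ j * (m.choose j : ℝ)) ∧
    ∀ (w : Fin m → ZMod 3) (i : ℕ), hammingNorm w = i → 1 ≤ i →
      (walsh (gfun m k₁ k₂) w).re
        = -(3 / 2) * ((Lloyd k₂ i m : ℝ) - (Lloyd (k₁ - 1) i m : ℝ)) := by
  refine ⟨?_, ?_⟩
  · rw [walsh_gfun_re (by omega), hammingNorm_zero, if_pos rfl]
    simp [Kraw_zero]
  · rintro w i rfl hi
    rw [walsh_gfun_re (by omega), if_neg (by omega), ← Int.cast_sub,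
      Lloyd_sub_Lloyd (by omega) (by omega), Int.cast_sum]
    ring
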